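/- Let Ω ⊂ ℝ^n be a bounded open set with C² boundary, β > 0, g ∈ C²(Ω̄) with Δg ∈ L^∞(Ω) and ∂_ν g = 0 on ∂Ω, and let u ∈ C²(Ω̄) solve Δu = β(u − g) in Ω with ∂_ν u = 0 on ∂Ω. Then ‖u − g‖_∞ ≤ (1/β)‖Δg‖_∞, and consequently ‖Δu‖_∞ ≤ ‖Δg‖_∞. -/

import Mathlib

open RealInnerProductSpace

/-- `Ω` has `C²` boundary with outer unit (co)normal direction `ν`: near each
boundary point, `Ω` is the sublevel set of a `C²` defining function whose
gradient at the point is the unit vector `ν x`. -/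
def HasC2Boundary {n : ℕ} (Ω : Set (EuclideanSpace ℝ (Fin n)))
    (ν : EuclideanSpace ℝ (Fin n) → EuclideanSpace ℝ (Fin n)) : Prop :=
  ∀ x ∈ frontier Ω, ∃ f : EuclideanSpace ℝ (Fin n) → ℝ,
    ∃ U : Set (EuclideanSpace ℝ (Fin n)), IsOpen U ∧ x ∈ U ∧
      ContDiffOn ℝ 2 f U ∧ (∀ y ∈ U, (y ∈ Ω ↔ f y < 0)) ∧
      HasGradientAt f (ν x) x ∧ ‖ν x‖ = 1

open Set Filter Topology

section aux
variable {E : Type*} [NormedAddCommGroup E] [InnerProductSpace ℝ E]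

lemma aux_first {S : Set E} {x e : E} {w : E → ℝ} {L : E →L[ℝ] ℝ}
    (hL : HasFDerivWithinAt w L S x) (hmax : ∀ y ∈ S, w y ≤ w x)
    (he : ∀ᶠ t : ℝ in 𝓝[>] 0, x + t • e ∈ S) : L e ≤ 0 := by
  have h : IsLocalMaxOn w S x := by
    filter_upwards [self_mem_nhdsWithin] with y hy using hmax y hy
  exact h.hasFDerivWithinAt_nonpos hL (mem_posTangentConeAt_of_frequently_mem he.frequently)

lemma aux_unique {S : Set E} {x e : E} {w : E → ℝ} {L L' : E →L[ℝ] ℝ}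
    (hL : HasFDerivWithinAt w L S x) (hL' : HasFDerivWithinAt w L' S x)
    (he : ∀ᶠ t : ℝ in 𝓝[>] 0, x + t • e ∈ S) : L e = L' e := by
  have h1 := aux_first (hL.sub hL') (by simp) he
  have h2 := aux_first (hL'.sub hL) (by simp) he
  simp at h1 h2
  linarith

lemma aux_second {S : Set E} {x e : E} {w : E → ℝ} {w1 : E → E →L[ℝ] ℝ}
    {w2 : E → E →L[ℝ] E →L[ℝ] ℝ} (hx : x ∈ S)
    (h1 : ∀ᶠ y in 𝓝[S] x, HasFDerivWithinAt w (w1 y) S y)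
    (h2 : ∀ᶠ y in 𝓝[S] x, HasFDerivWithinAt w1 (w2 y) S y)
    (hc : ContinuousWithinAt w2 S x) (hmax : ∀ y ∈ S, w y ≤ w x)
    (h0 : w1 x e = 0)
    (he : ∀ᶠ t : ℝ in 𝓝[>] 0, x + t • e ∈ S) : w2 x e e ≤ 0 := by
  by_contra! hpos
  have hc' : ContinuousWithinAt (fun y => w2 y e e) S x :=
    (hc.clm_apply continuousWithinAt_const).clm_apply continuousWithinAt_const
  have h3 : ∀ᶠ y in 𝓝[S] x, 0 < w2 y e e := hc'.eventually (lt_mem_nhds hpos)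
  have hall : ∀ᶠ y in 𝓝[S] x, y ∈ S ∧ HasFDerivWithinAt w (w1 y) S y ∧
      HasFDerivWithinAt w1 (w2 y) S y ∧ 0 < w2 y e e := by
    filter_upwards [h1, h2, h3, self_mem_nhdsWithin] with y a b c d using ⟨d, a, b, c⟩
  have htend : Tendsto (fun t : ℝ => x + t • e) (𝓝[>] 0) (𝓝[S] x) := by
    refine tendsto_nhdsWithin_iff.2 ⟨?_, he⟩
    have : Continuous (fun t : ℝ => x + t • e) := by fun_prop
    have := this.tendsto 0
    simp at this
    exact this.mono_left nhdsWithin_le_nhds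
  have hev := htend.eventually hall
  obtain ⟨δ, hδ, hδ'⟩ := mem_nhdsGT_iff_exists_Ioo_subset.1 hev
  have hδ0 : (0:ℝ) < δ := hδ
  have hall0 := hall.self_of_nhdsWithin hx
  have key : ∀ t ∈ Ico 0 δ, x + t • e ∈ S ∧ HasFDerivWithinAt w (w1 (x + t • e)) S (x + t • e) ∧
      HasFDerivWithinAt w1 (w2 (x + t • e)) S (x + t • e) ∧ 0 < w2 (x + t • e) e e := by
    intro t ht
    rcases eq_or_lt_of_le ht.1 with h | h
    · subst h; simpa using hall0
    · exact hδ' ⟨h, ht.2⟩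
  have hmaps : MapsTo (fun t : ℝ => x + t • e) (Ico 0 δ) S := fun t ht => (key t ht).1
  have hline : ∀ t : ℝ, HasDerivWithinAt (fun t : ℝ => x + t • e) e (Ico 0 δ) t := by
    intro t
    simpa using (((hasDerivAt_id t).smul_const e).const_add x).hasDerivWithinAt
  have d1 : ∀ t ∈ Ico 0 δ, HasDerivWithinAt (fun t : ℝ => w (x + t • e)) (w1 (x + t • e) e)
      (Ico 0 δ) t := fun t ht =>
    (key t ht).2.1.comp_hasDerivWithinAt t (hline t) hmaps
  have d2 : ∀ t ∈ Ico 0 δ, HasDerivWithinAt (fun t : ℝ => w1 (x + t • e) e)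
      (w2 (x + t • e) e e) (Ico 0 δ) t := fun t ht => by
    have := (key t ht).2.2.1.comp_hasDerivWithinAt t (hline t) hmaps
    simpa using this.clm_apply (hasDerivWithinAt_const t (Ico 0 δ) e)
  have m2 : StrictMonoOn (fun t : ℝ => w1 (x + t • e) e) (Ico 0 δ) := by
    refine strictMonoOn_of_deriv_pos (convex_Ico 0 δ)
      (fun t ht => (d2 t ht).continuousWithinAt) ?_
    intro t ht
    have ht' := interior_subset ht
    rw [((d2 t ht').hasDerivAt (mem_interior_iff_mem_nhds.1 ht)).deriv]
    exact (key t ht').2.2.2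
  have m1 : StrictMonoOn (fun t : ℝ => w (x + t • e)) (Ico 0 δ) := by
    refine strictMonoOn_of_deriv_pos (convex_Ico 0 δ)
      (fun t ht => (d1 t ht).continuousWithinAt) ?_
    intro t ht
    have ht' := interior_subset ht
    rw [((d1 t ht').hasDerivAt (mem_interior_iff_mem_nhds.1 ht)).deriv]
    rw [interior_Ico] at ht
    have := m2 ⟨le_rfl, hδ0⟩ ht' ht.1
    simpa [h0] using this
  have hh : δ / 2 ∈ Ico 0 δ := ⟨by positivity, by linarith⟩
  have := m1 ⟨le_rfl, hδ0⟩ hh (by positivity : (0:ℝ) < δ / 2)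
  have h5 := hmax _ (key _ hh).1
  simp at this
  linarith

/-- Conclusions at a maximum point: `w2 x e e ≤ 0` in all directions. -/
lemma aux_hess {S : Set E} {x : E} {w : E → ℝ} {w1 : E → E →L[ℝ] ℝ}
    {w2 : E → E →L[ℝ] E →L[ℝ] ℝ} (hx : x ∈ S) (G : E)
    (hG : ∀ L : E →L[ℝ] ℝ, HasFDerivWithinAt w L S x → ∀ e,
      (∀ᶠ t : ℝ in 𝓝[>] 0, x + t • e ∈ S) → L e = inner ℝ G e)
    (h1 : ∀ᶠ y in 𝓝[S] x, HasFDerivWithinAt w (w1 y) S y)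
    (h2 : ∀ᶠ y in 𝓝[S] x, HasFDerivWithinAt w1 (w2 y) S y)
    (hc : ContinuousWithinAt w2 S x) (hmax : ∀ y ∈ S, w y ≤ w x)
    (hA : (∀ e, ∀ᶠ t : ℝ in 𝓝[>] 0, x + t • e ∈ S) ∨
      (∃ ν : E, ‖ν‖ = 1 ∧ inner ℝ G ν = 0 ∧
        ∀ e, inner ℝ ν e < 0 → ∀ᶠ t : ℝ in 𝓝[>] 0, x + t • e ∈ S)) (e : E) :
    w2 x e e ≤ 0 := by
  have h1x : HasFDerivWithinAt w (w1 x) S x := h1.self_of_nhdsWithin hx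
  have hle : ∀ e, (∀ᶠ t : ℝ in 𝓝[>] 0, x + t • e ∈ S) → inner ℝ G e ≤ 0 := fun e he => by
    rw [← hG _ h1x e he]; exact aux_first h1x hmax he
  have hG0 : G = 0 := by
    rcases hA with hA | ⟨ν, hν, hGν, hA⟩
    · exact real_inner_self_nonpos.1 (hle G (hA G))
    · have := hle (G - ν) (hA _ (by
        rw [inner_sub_right, real_inner_comm, hGν, real_inner_self_eq_norm_sq, hν]; norm_num))
      rw [inner_sub_right, hGν, sub_zero] at this
      exact real_inner_self_nonpos.1 this
  have hsec : ∀ e, (∀ᶠ t : ℝ in 𝓝[>] 0, x + t • e ∈ S) → w2 x e e ≤ 0 := fun e he =>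
    aux_second hx h1 h2 hc hmax (by rw [hG _ h1x e he, hG0, inner_zero_left]) he
  rcases hA with hA | ⟨ν, hν, hGν, hA⟩
  · exact hsec e (hA e)
  · have hneg : ∀ e, inner ℝ ν e ≤ 0 → w2 x e e ≤ 0 := by
      intro e he
      have hcont : Continuous (fun s : ℝ => w2 x (e - s • ν) (e - s • ν)) := by fun_prop
      have ht : Tendsto (fun s : ℝ => w2 x (e - s • ν) (e - s • ν)) (𝓝[>] 0) (𝓝 (w2 x e e)) := by
        have := hcont.tendsto 0
        simp only [zero_smul, sub_zero] at this
        exact this.mono_left nhdsWithin_le_nhds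
      refine le_of_tendsto ht ?_
      filter_upwards [self_mem_nhdsWithin] with s hs
      have hs : 0 < s := hs
      refine hsec _ (hA _ ?_)
      rw [inner_sub_right, inner_smul_right, real_inner_self_eq_norm_sq, hν]
      linarith
    rcases le_total (inner ℝ ν e) 0 with h | h
    · exact hneg e h
    · simpa using hneg (-e) (by simpa using h)

end aux

lemma aux_T (n : ℕ) : ∃ T : (EuclideanSpace ℝ (Fin n) →L[ℝ] ℝ) →L[ℝ] EuclideanSpace ℝ (Fin n),
    (∀ v, T (InnerProductSpace.toDual ℝ (EuclideanSpace ℝ (Fin n)) v) = v) ∧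
    ∀ l v, inner ℝ v (T l) = l v := by
  let T : (EuclideanSpace ℝ (Fin n) →L[ℝ] ℝ) →ₗ[ℝ] EuclideanSpace ℝ (Fin n) :=
    { toFun := fun l => (InnerProductSpace.toDual ℝ (EuclideanSpace ℝ (Fin n))).symm l
      map_add' := fun a b => map_add _ a b
      map_smul' := fun c a => by simp }
  refine ⟨LinearMap.toContinuousLinearMap T, fun v => ?_, fun l v => ?_⟩
  · exact (InnerProductSpace.toDual ℝ (EuclideanSpace ℝ (Fin n))).symm_apply_apply v
  · rw [real_inner_comm]
    exact InnerProductSpace.toDual_symm_apply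

lemma aux_main (n : ℕ) (Ω : Set (EuclideanSpace ℝ (Fin n)))
    (hΩ : IsOpen Ω) (hΩb : Bornology.IsBounded Ω) (hΩne : Ω.Nonempty)
    (ν : EuclideanSpace ℝ (Fin n) → EuclideanSpace ℝ (Fin n))
    (hbd : HasC2Boundary Ω ν)
    (β M : ℝ) (hβ : 0 < β)
    (w : EuclideanSpace ℝ (Fin n) → ℝ)
    (gradW : EuclideanSpace ℝ (Fin n) → EuclideanSpace ℝ (Fin n))
    (hw2 : ContDiffOn ℝ 2 w (closure Ω))
    (hgradW : ∀ x ∈ closure Ω, HasGradientWithinAt w (gradW x) (closure Ω) x)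
    (hlap : ∀ x ∈ Ω, β * w x - M ≤ LinearMap.trace ℝ (EuclideanSpace ℝ (Fin n))
      ((fderiv ℝ gradW x : EuclideanSpace ℝ (Fin n) →L[ℝ] EuclideanSpace ℝ (Fin n)) :
        EuclideanSpace ℝ (Fin n) →ₗ[ℝ] EuclideanSpace ℝ (Fin n)))
    (hN : ∀ x ∈ frontier Ω, inner ℝ (gradW x) (ν x) = 0) :
    ∀ x ∈ closure Ω, β * w x ≤ M := by
  have hcomp : IsCompact (closure Ω) := hΩb.isCompact_closure
  obtain ⟨x, hx, hmax⟩ := hcomp.exists_isMaxOn hΩne.closure hw2.continuousOn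
  have hmax : ∀ y ∈ closure Ω, w y ≤ w x := hmax
  suffices h : β * w x ≤ M from fun y hy =>
    (mul_le_mul_of_nonneg_left (hmax y hy) hβ.le).trans h
  have hcd : ContDiffWithinAt ℝ (1 + 1) w (closure Ω) x := by
    have h := hw2 x hx
    have h11 : (1 + 1 : WithTop ℕ∞) = 2 := one_add_one_eq_two
    exact h11 ▸ h
  obtain ⟨U, hU, -, -, w1, hw1, hw1c⟩ :=
    (contDiffWithinAt_succ_iff_hasFDerivWithinAt' (by decide)).1 hcd
  have hw1c : ContDiffWithinAt ℝ (0 + 1) w1 (closure Ω) x := by simpa using hw1c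
  obtain ⟨V, hV, -, -, w2, hw2', hw2c⟩ :=
    (contDiffWithinAt_succ_iff_hasFDerivWithinAt' (by decide)).1 hw1c
  rw [insert_eq_of_mem hx] at hU hV
  have h1 : ∀ᶠ y in 𝓝[closure Ω] x, HasFDerivWithinAt w (w1 y) (closure Ω) y := by
    filter_upwards [hU] with y hy using hw1 y hy
  have h2 : ∀ᶠ y in 𝓝[closure Ω] x, HasFDerivWithinAt w1 (w2 y) (closure Ω) y := by
    filter_upwards [hV] with y hy using hw2' y hy
  have hc : ContinuousWithinAt w2 (closure Ω) x := hw2c.continuousWithinAt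
  have hA : (∀ e, ∀ᶠ t : ℝ in 𝓝[>] 0, x + t • e ∈ closure Ω) ∨
      (∃ ν : EuclideanSpace ℝ (Fin n), ‖ν‖ = 1 ∧ inner ℝ (gradW x) ν = 0 ∧
        ∀ e, inner ℝ ν e < 0 → ∀ᶠ t : ℝ in 𝓝[>] 0, x + t • e ∈ closure Ω) := by
    have hline : ∀ e, Tendsto (fun t : ℝ => x + t • e) (𝓝[>] 0) (𝓝 x) := fun e => by
      have : Continuous (fun t : ℝ => x + t • e) := by fun_prop
      have := this.tendsto 0
      simp only [zero_smul, add_zero] at this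
      exact this.mono_left nhdsWithin_le_nhds
    by_cases hxΩ : x ∈ Ω
    · left
      intro e
      filter_upwards [(hline e).eventually (hΩ.mem_nhds hxΩ)] with t ht using subset_closure ht
    · right
      have hfr : x ∈ frontier Ω := by rw [hΩ.frontier_eq]; exact ⟨hx, hxΩ⟩
      obtain ⟨f, W, hW, hxW, -, hf, hgr, hν⟩ := hbd x hfr
      refine ⟨ν x, hν, hN x hfr, fun e he => ?_⟩
      have hfx : f x ≤ 0 := by
        by_contra! hpos
        have hcont : ContinuousAt f x := hgr.hasFDerivAt.continuousAt
        have hev : ∀ᶠ y in 𝓝 x, 0 < f y ∧ y ∈ W :=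
          (hcont.eventually (lt_mem_nhds hpos)).and (hW.mem_nhds hxW)
        obtain ⟨y, hy, hyΩ⟩ := mem_closure_iff_nhds.1 hx _ hev
        have hy : 0 < f y ∧ y ∈ W := hy
        have := (hf y hy.2).1 hyΩ
        linarith
      have hd : HasDerivAt (fun t : ℝ => f (x + t • e)) (inner ℝ (ν x) e) 0 := by
        have hl : HasDerivAt (fun t : ℝ => x + t • e) e 0 := by
          simpa using ((hasDerivAt_id (0:ℝ)).smul_const e).const_add x
        have := HasFDerivAt.comp_hasDerivAt_of_eq (0:ℝ) hgr.hasFDerivAt hl (by simp)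
        simpa [Function.comp_def] using this
      have hs := (hasDerivAt_iff_tendsto_slope.1 hd).mono_left
        (nhdsWithin_mono (0:ℝ) (fun t (ht : 0 < t) => ne_of_gt ht : Ioi (0:ℝ) ⊆ {0}ᶜ))
      filter_upwards [hs.eventually (gt_mem_nhds he), (hline e).eventually (hW.mem_nhds hxW),
        self_mem_nhdsWithin] with t ht htW ht0
      have ht0 : 0 < t := ht0
      refine subset_closure ((hf _ htW).2 ?_)
      rw [slope_def_field, div_lt_iff₀ (by linarith)] at ht
      simp at ht
      linarith
  have hH : ∀ e, w2 x e e ≤ 0 := aux_hess hx (gradW x)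
    (fun L hL e he => by
      rw [aux_unique hL (hgradW x hx).hasFDerivWithinAt he]; simp) h1 h2 hc hmax hA
  let b := EuclideanSpace.basisFun (Fin n) ℝ
  -- the trace identity near `x`
  have hnw : 𝓝[Ω] x ≤ 𝓝[closure Ω] x := nhdsWithin_mono _ subset_closure
  have hnb : ∀ y ∈ Ω, closure Ω ∈ 𝓝 y := fun y hy =>
    mem_of_superset (hΩ.mem_nhds hy) subset_closure
  have heq : ∀ᶠ y in 𝓝[Ω] x, w1 y = InnerProductSpace.toDual ℝ _ (gradW y) := by
    filter_upwards [hnw h1, self_mem_nhdsWithin] with y hy hyΩ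
    exact (hy.hasFDerivAt (hnb y hyΩ)).unique
      ((hgradW y (subset_closure hyΩ)).hasFDerivWithinAt.hasFDerivAt (hnb y hyΩ))
  have htr : ∀ᶠ y in 𝓝[Ω] x, β * w y - M ≤ ∑ i, w2 y (b i) (b i) := by
    filter_upwards [hnw h2, self_mem_nhdsWithin, eventually_eventually_nhdsWithin.2 heq]
      with y hy hyΩ hye
    rw [hΩ.nhdsWithin_eq hyΩ] at hye
    have hd := hy.hasFDerivAt (hnb y hyΩ)
    have hd2 := hd.congr_of_eventuallyEq (f₁ := fun z => InnerProductSpace.toDual ℝ _ (gradW z))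
      (hye.mono fun z hz => hz.symm)
    obtain ⟨T, hTv, hTi⟩ := aux_T n
    have hd3 : HasFDerivAt gradW (T.comp (w2 y)) y := by
      have := T.hasFDerivAt.comp y hd2
      refine this.congr_of_eventuallyEq (Eventually.of_forall fun z => ?_)
      simp only [Function.comp, hTv]
    have := hlap y hyΩ
    rw [hd3.fderiv, LinearMap.trace_eq_sum_inner _ b] at this
    simpa [hTi] using this
  have hne : (𝓝[Ω] x).NeBot := mem_closure_iff_nhdsWithin_neBot.1 hx
  have hl : Tendsto (fun y => β * w y - M) (𝓝[Ω] x) (𝓝 (β * w x - M)) :=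
    (((hw2.continuousOn x hx).tendsto.mono_left hnw).const_mul β).sub_const M
  have hr : Tendsto (fun y => ∑ i, w2 y (b i) (b i)) (𝓝[Ω] x) (𝓝 (∑ i, w2 x (b i) (b i))) := by
    refine tendsto_finsetSum _ fun i _ => ?_
    have hc' : ContinuousWithinAt (fun y => w2 y (b i) (b i)) (closure Ω) x :=
      (hc.clm_apply continuousWithinAt_const).clm_apply continuousWithinAt_const
    exact hc'.tendsto.mono_left hnw
  have hfin := le_of_tendsto_of_tendsto hl hr htr
  have hsum : ∑ i, w2 x (b i) (b i) ≤ 0 := Finset.sum_nonpos fun i _ => hH (b i)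
  linarith

lemma aux_grad_diff {n : ℕ} {Ω : Set (EuclideanSpace ℝ (Fin n))} (hΩ : IsOpen Ω)
    {u : EuclideanSpace ℝ (Fin n) → ℝ}
    {G : EuclideanSpace ℝ (Fin n) → EuclideanSpace ℝ (Fin n)}
    (hu2 : ContDiffOn ℝ 2 u (closure Ω))
    (hG : ∀ x ∈ closure Ω, HasGradientWithinAt u (G x) (closure Ω) x)
    {x : EuclideanSpace ℝ (Fin n)} (hx : x ∈ Ω) : DifferentiableAt ℝ G x := by
  have hu : ContDiffAt ℝ 2 u x := (hu2.mono subset_closure).contDiffAt (hΩ.mem_nhds hx)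
  have hd : DifferentiableAt ℝ (fderiv ℝ u) x :=
    (hu.fderiv_right (m := 1) (by norm_num)).differentiableAt (by norm_num)
  obtain ⟨T, hTv, hTi⟩ := aux_T n
  have h := (T.differentiableAt (x := fderiv ℝ u x)).comp x hd
  refine h.congr_of_eventuallyEq ?_
  filter_upwards [hΩ.mem_nhds hx] with y hy
  have := (hG y (subset_closure hy)).hasFDerivWithinAt.hasFDerivAt
    (mem_of_superset (hΩ.mem_nhds hy) subset_closure)
  simp [this.fderiv, hTv]

/-- Comparison estimate for the Neumann problem `Δu = β(u−g)`, `∂_ν u = 0`: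
`‖u − g‖_∞ ≤ β⁻¹‖Δg‖_∞`, and consequently `‖Δu‖_∞ ≤ ‖Δg‖_∞`. -/
theorem stmt13 (n : ℕ) (Ω : Set (EuclideanSpace ℝ (Fin n)))
    (hΩ : IsOpen Ω) (hΩb : Bornology.IsBounded Ω) (hΩne : Ω.Nonempty)
    (ν : EuclideanSpace ℝ (Fin n) → EuclideanSpace ℝ (Fin n))
    (hbd : HasC2Boundary Ω ν)
    (β : ℝ) (hβ : 0 < β)
    (u g : EuclideanSpace ℝ (Fin n) → ℝ)
    (gradU gradG : EuclideanSpace ℝ (Fin n) → EuclideanSpace ℝ (Fin n))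
    (lapU lapG : EuclideanSpace ℝ (Fin n) → ℝ)
    -- `u, g ∈ C²(Ω̄)`
    (hu2 : ContDiffOn ℝ 2 u (closure Ω)) (hg2 : ContDiffOn ℝ 2 g (closure Ω))
    (hgradU : ∀ x ∈ closure Ω, HasGradientWithinAt u (gradU x) (closure Ω) x)
    (hgradG : ∀ x ∈ closure Ω, HasGradientWithinAt g (gradG x) (closure Ω) x)
    -- `lapU = Δu`, `lapG = Δg` in `Ω`
    (hlapU : ∀ x ∈ Ω, lapU x = LinearMap.trace ℝ (EuclideanSpace ℝ (Fin n))
      ((fderiv ℝ gradU x : EuclideanSpace ℝ (Fin n) →L[ℝ] EuclideanSpace ℝ (Fin n)) :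
        EuclideanSpace ℝ (Fin n) →ₗ[ℝ] EuclideanSpace ℝ (Fin n)))
    (hlapG : ∀ x ∈ Ω, lapG x = LinearMap.trace ℝ (EuclideanSpace ℝ (Fin n))
      ((fderiv ℝ gradG x : EuclideanSpace ℝ (Fin n) →L[ℝ] EuclideanSpace ℝ (Fin n)) :
        EuclideanSpace ℝ (Fin n) →ₗ[ℝ] EuclideanSpace ℝ (Fin n)))
    -- `Δg` is bounded on `Ω`
    (hgb : BddAbove ((fun x => |lapG x|) '' Ω))
    -- the equation `Δu = β(u − g)` in `Ω`
    (hpde : ∀ x ∈ Ω, lapU x = β * (u x - g x))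
    -- Neumann conditions `∂_ν u = 0` and `∂_ν g = 0` on `∂Ω`
    (hNu : ∀ x ∈ frontier Ω, ⟪gradU x, ν x⟫ = 0)
    (hNg : ∀ x ∈ frontier Ω, ⟪gradG x, ν x⟫ = 0) :
    (∀ x ∈ closure Ω, |u x - g x| ≤ (1 / β) * sSup ((fun y => |lapG y|) '' Ω)) ∧
    (∀ x ∈ Ω, |lapU x| ≤ sSup ((fun y => |lapG y|) '' Ω)) := by
  set M := sSup ((fun y => |lapG y|) '' Ω) with hM
  have hMb : ∀ x ∈ Ω, |lapG x| ≤ M := fun x hx => le_csSup hgb ⟨x, hx, rfl⟩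
  have hdU := fun x (hx : x ∈ Ω) => aux_grad_diff hΩ hu2 hgradU hx
  have hdG := fun x (hx : x ∈ Ω) => aux_grad_diff hΩ hg2 hgradG hx
  have hup : ∀ x ∈ closure Ω, β * (u x - g x) ≤ M := by
    refine aux_main n Ω hΩ hΩb hΩne ν hbd β M hβ (fun x => u x - g x)
      (fun x => gradU x - gradG x) (hu2.sub hg2) ?_ ?_ ?_
    · intro x hx
      have := (hgradU x hx).hasFDerivWithinAt.sub (hgradG x hx).hasFDerivWithinAt
      rw [hasGradientWithinAt_iff_hasFDerivWithinAt, map_sub]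
      exact this
    · intro x hx
      rw [fderiv_fun_sub (hdU x hx) (hdG x hx), ContinuousLinearMap.toLinearMap_sub, map_sub,
        ← hlapU x hx, ← hlapG x hx, hpde x hx]
      have := (abs_le.1 (hMb x hx)).2
      linarith
    · intro x hx
      rw [inner_sub_left, hNu x hx, hNg x hx, sub_zero]
  have hlo : ∀ x ∈ closure Ω, β * (g x - u x) ≤ M := by
    refine aux_main n Ω hΩ hΩb hΩne ν hbd β M hβ (fun x => g x - u x)
      (fun x => gradG x - gradU x) (hg2.sub hu2) ?_ ?_ ?_
    · intro x hx
      have := (hgradG x hx).hasFDerivWithinAt.sub (hgradU x hx).hasFDerivWithinAt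
      rw [hasGradientWithinAt_iff_hasFDerivWithinAt, map_sub]
      exact this
    · intro x hx
      rw [fderiv_fun_sub (hdG x hx) (hdU x hx), ContinuousLinearMap.toLinearMap_sub, map_sub,
        ← hlapU x hx, ← hlapG x hx, hpde x hx]
      have := (abs_le.1 (hMb x hx)).1
      linarith
    · intro x hx
      rw [inner_sub_left, hNu x hx, hNg x hx, sub_zero]
  have habs : ∀ x ∈ closure Ω, |β * (u x - g x)| ≤ M := fun x hx =>
    abs_le.2 ⟨by linarith [hlo x hx], hup x hx⟩
  refine ⟨fun x hx => ?_, fun x hx => ?_⟩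
  · have := habs x hx
    rw [abs_mul, abs_of_pos hβ] at this
    rw [one_div, inv_mul_eq_div, le_div_iff₀ hβ]
    linarith
  · rw [hpde x hx]
    exact habs x (subset_closure hx)
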